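/- Let v be a node of a tree P with children v_1,…,v_k ordered from left to right, where k ≥ 2, and let T be a tree. Then emb(P(v),T) = Deep({fl(nca(w_1,w_k), label(v)) : (w_1,w_k) ∈ mop(emb(P(v_1),T),…,emb(P(v_k),T))} ∖ {⊥}), where terms with fl(nca(w_1,w_k), label(v)) = ⊥ are discarded. -/

import Mathlib

namespace TreeIncl

/-- Rooted, ordered, labeled trees: a label and an ordered list of children. -/
inductive OTree (α : Type) : Type where
  | node : α → List (OTree α) → OTree α

namespace OTree

variable {α β : Type}

/-- The label of the root. -/
def label : OTree α → α
  | node a _ => a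

/-- The (ordered) children subtrees of the root. -/
def children : OTree α → List (OTree α)
  | node _ cs => cs

/-- Nodes are identified with positions: lists of child indices from the root. -/
abbrev Node : Type := List ℕ

/-- The subtree rooted at a given position, if the position is valid. -/
def sub : Node → OTree α → Option (OTree α)
  | [], t => some t
  | i :: p, t =>
    match t.children[i]? with
    | some c => sub p c
    | none => none

/-- The set `V(T)` of (positions of) nodes of a tree. -/
def Pos (t : OTree α) : Set Node := {p | sub p t ≠ none}

/-- The label of the node at position `p`. -/
def labelAt (t : OTree α) (p : Node) : Option α := (sub p t).map label

/-- `l_T`: the number of leaves of a tree. -/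
def numLeaves : OTree α → ℕ
  | node _ [] => 1
  | node a (c :: cs) => numLeaves c + numLeaves (node a cs)

/-- `n_T`: the number of nodes of a tree. -/
def numNodes : OTree α → ℕ
  | node _ [] => 1
  | node a (c :: cs) => numNodes c + numNodes (node a cs)

/-- The number of leaves of the subtree rooted at position `p` (0 if `p` is invalid). -/
def leavesAt (t : OTree α) (p : Node) : ℕ := ((sub p t).map numLeaves).getD 0

/-- `v ⪯ w` : `v` is an ancestor of `w` (positions: prefix). -/
def Anc (v w : Node) : Prop := v <+: w

/-- `v ≺ w` : `v` is a proper ancestor of `w` (positions: strict prefix). -/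
def SAnc (v w : Node) : Prop := v <+: w ∧ v ≠ w

/-- `u ◁ w` : `u` is to the left of `w`
    (equivalently: `pre(u) < pre(w)` and `post(u) < post(w)`). -/
def LeftOf (u w : Node) : Prop :=
  ∃ (q : Node) (i j : ℕ) (u' w' : Node), i < j ∧ u = q ++ i :: u' ∧ w = q ++ j :: w'

/-- `u ⊴ w` : `u ◁ w` or `u ⪯ w` or `w ≺ u`. -/
def LeftOrAbove (u w : Node) : Prop := LeftOf u w ∨ Anc u w ∨ SAnc w u

/-- The nearest common ancestor of two positions: longest common prefix. -/
def nca : Node → Node → Node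
  | [], _ => []
  | _, [] => []
  | i :: u, j :: w => if i = j then i :: nca u w else []

/-- A set of nodes is deep: no node is a proper ancestor of another node in the set. -/
def DeepSet (X : Set Node) : Prop := ∀ x ∈ X, ∀ y ∈ X, ¬ SAnc x y

/-- `Deep(X)`: the elements of `X` having no proper descendant in `X`. -/
def DeepOf (X : Set Node) : Set Node := {x | x ∈ X ∧ ¬ ∃ z ∈ X, SAnc x z}

/-- `Φ(X_1, …, X_k)`: xs is a tuple with `x_i ∈ X_i` and `x_1 ◁ x_2 ◁ ⋯ ◁ x_k`. -/
def Phi (Xs : List (Set Node)) (xs : List Node) : Prop :=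
  List.Forall₂ (fun x X => x ∈ X) xs Xs ∧ xs.Chain' LeftOf

/-- `mop(X_1, …, X_k)`: the set of minimum ordered pairs. -/
def Mop (Xs : List (Set Node)) : Set (Node × Node) :=
  {p | (∃ xs, Phi Xs xs ∧ xs.head? = some p.1 ∧ xs.getLast? = some p.2) ∧
    ¬ ∃ ys y1 yk, Phi Xs ys ∧ ys.head? = some y1 ∧ ys.getLast? = some yk ∧
      ((LeftOf p.1 y1 ∧ LeftOf y1 yk ∧ LeftOrAbove yk p.2) ∨
       (LeftOrAbove p.1 y1 ∧ LeftOf y1 yk ∧ LeftOf yk p.2))}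

/-- `MopRight(Y, X)`: for `(y₁,y₂) ∈ Y`, `(y₁,x)` is in the result iff
    `(y₂,x) ∈ mop(Y|₂, X)`. -/
def MopRight (Y : Set (Node × Node)) (X : Set Node) : Set (Node × Node) :=
  {r | ∃ y2, (r.1, y2) ∈ Y ∧ (y2, r.2) ∈ Mop [Prod.snd '' Y, X]}

/-- `MopLeft(X, Y)`: for `(y₁,y₂) ∈ Y`, `(x,y₂)` is in the result iff
    `(x,y₁) ∈ mop(X, Y|₁)`. -/
def MopLeft (X : Set Node) (Y : Set (Node × Node)) : Set (Node × Node) :=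
  {r | ∃ y1, (y1, r.2) ∈ Y ∧ (r.1, y1) ∈ Mop [X, Prod.fst '' Y]}

/-- One deletion step: delete a node of the tree, making its children children of its
parent (in its place, in order); the root may be deleted when it has exactly one
child. -/
inductive DelStep : OTree α → OTree α → Prop
  | root (a : α) (t : OTree α) : DelStep (node a [t]) t
  | splice (a b : α) (pre cs post : List (OTree α)) :
      DelStep (node a (pre ++ node b cs :: post)) (node a (pre ++ cs ++ post))
  | congr (a : α) (pre post : List (OTree α)) {t t' : OTree α} :
      DelStep t t' → DelStep (node a (pre ++ t :: post)) (node a (pre ++ t' :: post))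

/-- `P ⊑ T` : `P` can be obtained from `T` by deleting nodes of `T`. -/
def Included (P T : OTree α) : Prop := Relation.ReflTransGen (fun x y => DelStep x y) T P

/-- An embedding of `P` in `T`: an injective map of nodes preserving labels,
    proper ancestorship, and the left-of relation. -/
structure IsEmb (P T : OTree α) (f : Node → Node) : Prop where
  mem : ∀ p ∈ Pos P, f p ∈ Pos T
  inj : ∀ p ∈ Pos P, ∀ q ∈ Pos P, f p = f q → p = q
  lab : ∀ p ∈ Pos P, labelAt T (f p) = labelAt P p
  anc : ∀ p ∈ Pos P, ∀ q ∈ Pos P, (SAnc p q ↔ SAnc (f p) (f q))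
  ord : ∀ p ∈ Pos P, ∀ q ∈ Pos P, (LeftOf p q ↔ LeftOf (f p) (f q))

/-- A deep embedding: no other embedding maps the root of `P` strictly deeper. -/
def IsDeepEmb (P T : OTree α) (f : Node → Node) : Prop :=
  IsEmb P T f ∧ ¬ ∃ g, IsEmb P T g ∧ SAnc (f []) (g [])

/-- `emb(P,T)`: the set of deep occurrences of `P` in `T`. -/
def emb (P T : OTree α) : Set Node := {w | ∃ f, IsDeepEmb P T f ∧ f [] = w}

/-- `FlAt T x a q` : `q = fl(x, a)`, the first ancestor of `x` labeled `a` in `T`. -/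
def FlAt (t : OTree α) (x : Node) (a : α) (q : Node) : Prop :=
  q <+: x ∧ labelAt t q = some a ∧ ∀ r, SAnc q r → r <+: x → labelAt t r ≠ some a

/-! ### Heavy leaf path decompositions -/

/-- `hv` is a heavy leaf path decomposition of `P`: for each internal node (position)
`p`, `hv p` is the index of a child with the maximum number of descendant leaves. -/
def IsHeavyDecomp (P : OTree α) (hv : Node → ℕ) : Prop :=
  ∀ p s, sub p P = some s → s.children ≠ [] →
    ∃ c, s.children[hv p]? = some c ∧ ∀ c' ∈ s.children, numLeaves c' ≤ numLeaves c

/-- `ldepth(v)`: the number of light edges on the path from the root to `v`. -/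
def ldepth (hv : Node → ℕ) (v : Node) : ℕ :=
  (List.range v.length).countP (fun n => v.getD n 0 != hv (v.take n))

/-- The light nodes on the path from the root to `v`, ordered by increasing depth
    (the root is light; a nonroot node is light iff it is not the heavy child
    of its parent). -/
def lightPrefixes (hv : Node → ℕ) (v : Node) : List Node :=
  ((List.range (v.length + 1)).map (fun n => v.take n)).filter
    (fun q => q.getLast? != some (hv q.dropLast))

/-- The position of `heavy(parent(q))` for a nonroot position `q`. -/
def heavySibPos (hv : Node → ℕ) (q : Node) : Node :=
  q.dropLast ++ [hv q.dropLast]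

/-! ### Clusters -/

/-- Two positions are adjacent in the tree (parent/child). -/
def Adj (u v : Node) : Prop := (∃ i, v = u ++ [i]) ∨ (∃ i, u = v ++ [i])

/-- `S` is (the vertex set of) a nonempty connected subgraph of `T`. -/
def Conn (T : OTree α) (S : Set Node) : Prop :=
  S.Nonempty ∧ S ⊆ Pos T ∧
    ∀ u ∈ S, ∀ v ∈ S, ∀ w, nca u v <+: w → (w <+: u ∨ w <+: v) → w ∈ S

/-- The boundary nodes of a connected subgraph `S` of `T`: nodes of `S` adjacent to a
node of `T` outside `S`, together with the root of `T` if it lies in `S`. -/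
def Boundary (T : OTree α) (S : Set Node) : Set Node :=
  {v ∈ S | (∃ u ∈ Pos T, u ∉ S ∧ Adj v u) ∨ v = []}

/-- The edges of `T` joining two nodes of `S`. -/
def EdgesIn (T : OTree α) (S : Set Node) : Set (Node × Node) :=
  {e | e.1 ∈ S ∧ e.2 ∈ S ∧ e.2 ∈ Pos T ∧ ∃ i, e.2 = e.1 ++ [i]}

/-- A cluster of `T`: a connected subgraph with at most two boundary nodes. -/
def IsCluster (T : OTree α) (S : Set Node) : Prop :=
  Conn T S ∧ (Boundary T S).encard ≤ 2

/-- A cluster partition of `T`. -/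
structure IsClusterPartition (T : OTree α) (CS : List (Set Node)) : Prop where
  cluster : ∀ S ∈ CS, IsCluster T S
  coverV : ∀ p ∈ Pos T, ∃ S ∈ CS, p ∈ S
  coverE : ∀ e ∈ EdgesIn T (Pos T), ∃ S ∈ CS, e ∈ EdgesIn T S
  disjE : CS.Pairwise (fun S₁ S₂ => EdgesIn T S₁ ∩ EdgesIn T S₂ = ∅)
  edge : ∀ S ∈ CS, (EdgesIn T S).Nonempty

/-- Binary tree: every node has at most two children. -/
def IsBinary (t : OTree α) : Prop := ∀ p s, sub p t = some s → s.children.length ≤ 2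

/-- Relabeling of a tree. -/
def omap (f : α → β) : OTree α → OTree β
  | node a cs => node (f a) (cs.attach.map (fun c => omap f c.1))
termination_by t => sizeOf t
decreasing_by
  have := List.sizeOf_lt_of_mem c.2
  simp only [OTree.node.sizeOf_spec]
  omega


/-! ### Relations between positions -/

theorem nil_anc (p : Node) : [] <+: p := ⟨p, rfl⟩

theorem sAnc_cons {i j : ℕ} {p q : Node} : SAnc (i :: p) (j :: q) ↔ i = j ∧ SAnc p q := by
  simp only [SAnc, List.cons_prefix_cons, ne_eq, List.cons.injEq]
  tauto

theorem leftOf_cons {i j : ℕ} {p q : Node} :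
    LeftOf (i :: p) (j :: q) ↔ i < j ∨ (i = j ∧ LeftOf p q) := by
  constructor
  · rintro ⟨r, a, b, u, w, hab, h1, h2⟩
    cases r with
    | nil =>
      simp only [List.nil_append, List.cons.injEq] at h1 h2
      left; omega
    | cons c r =>
      simp only [List.cons_append, List.cons.injEq] at h1 h2
      exact Or.inr ⟨h1.1.trans h2.1.symm, r, a, b, u, w, hab, h1.2, h2.2⟩
  · rintro (h | ⟨rfl, r, a, b, u, w, hab, rfl, rfl⟩)
    · exact ⟨[], i, j, p, q, h, rfl, rfl⟩
    · exact ⟨i :: r, a, b, u, w, hab, rfl, rfl⟩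

theorem not_leftOf_nil_left (q : Node) : ¬ LeftOf [] q := by
  rintro ⟨r, a, b, u, w, -, h, -⟩
  simp at h

theorem not_leftOf_nil_right (q : Node) : ¬ LeftOf q [] := by
  rintro ⟨r, a, b, u, w, -, -, h⟩
  simp at h

theorem LeftOf.trans {u v w : Node} (h1 : LeftOf u v) (h2 : LeftOf v w) : LeftOf u w := by
  induction u generalizing v w with
  | nil => exact absurd h1 (not_leftOf_nil_left _)
  | cons i u ih =>
    cases v with
    | nil => exact absurd h1 (not_leftOf_nil_right _)
    | cons j v =>
      cases w with
      | nil => exact absurd h2 (not_leftOf_nil_right _)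
      | cons k w =>
        rw [leftOf_cons] at *
        rcases h1 with h1 | ⟨rfl, h1⟩ <;> rcases h2 with h2 | ⟨rfl, h2⟩
        · left; omega
        · left; omega
        · left; omega
        · exact Or.inr ⟨rfl, ih h1 h2⟩

theorem LeftOf.irrefl (u : Node) : ¬ LeftOf u u := by
  rintro ⟨q, i, j, u', w', hij, h1, h2⟩
  rw [h1] at h2
  simp only [List.append_cancel_left_eq, List.cons.injEq] at h2
  omega

theorem LeftOf.mono {u v u' v' : Node} (h : LeftOf u v) (hu : u <+: u') (hv : v <+: v') :
    LeftOf u' v' := by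
  obtain ⟨q, i, j, x, y, hij, rfl, rfl⟩ := h
  obtain ⟨s, rfl⟩ := hu
  obtain ⟨t, rfl⟩ := hv
  exact ⟨q, i, j, x ++ s, y ++ t, hij, by simp, by simp⟩

theorem LeftOf.not_anc {u v : Node} (h : LeftOf u v) : ¬ u <+: v :=
  fun hp => LeftOf.irrefl v (h.mono hp List.prefix_rfl)

theorem LeftOf.not_anc' {u v : Node} (h : LeftOf u v) : ¬ v <+: u :=
  fun hp => LeftOf.irrefl u (h.mono List.prefix_rfl hp)

theorem LeftOf.asymm {u v : Node} (h : LeftOf u v) : ¬ LeftOf v u :=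
  fun h' => LeftOf.irrefl u (h.trans h')

theorem LeftOf.ne {u v : Node} (h : LeftOf u v) : u ≠ v := by
  rintro rfl
  exact LeftOf.irrefl _ h

theorem SAnc.trans_anc {u v w : Node} (h : SAnc u v) (h' : v <+: w) : SAnc u w := by
  refine ⟨h.1.trans h', ?_⟩
  rintro rfl
  exact h.2 (h.1.eq_of_length_le h'.length_le)

theorem SAnc.length_lt {u v : Node} (h : SAnc u v) : u.length < v.length := by
  by_contra hc
  exact h.2 (h.1.eq_of_length_le (not_lt.mp hc))

theorem SAnc.not_anc {u v : Node} (h : SAnc u v) : ¬ v <+: u :=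
  fun hp => absurd h.length_lt (not_lt.mpr hp.length_le)

theorem prefix_of_between {n u x w : Node} (hu : n <+: u) (hw : n <+: w)
    (h1 : LeftOf u x) (h2 : LeftOf x w) : n <+: x := by
  induction n generalizing u x w with
  | nil => exact (nil_anc _)
  | cons i n ih =>
    obtain ⟨s, rfl⟩ := hu
    obtain ⟨t, rfl⟩ := hw
    cases x with
    | nil => exact absurd h1 (not_leftOf_nil_right _)
    | cons j x =>
      simp only [List.cons_append, leftOf_cons] at h1 h2
      rcases h1 with h1 | ⟨rfl, h1⟩
      · omega
      · rcases h2 with h2 | ⟨-, h2⟩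
        · omega
        · rw [List.cons_prefix_cons]
          exact ⟨rfl, ih (List.prefix_append _ _) (List.prefix_append _ _) h1 h2⟩

theorem prefix_nca_iff {p u w : Node} : p <+: nca u w ↔ p <+: u ∧ p <+: w := by
  induction u generalizing p w with
  | nil =>
    simp only [nca, List.prefix_nil]
    exact ⟨fun h => ⟨h, h ▸ (nil_anc _)⟩, fun h => h.1⟩
  | cons i u ih =>
    cases w with
    | nil =>
      simp only [nca, List.prefix_nil]
      exact ⟨fun h => ⟨h ▸ (nil_anc _), h⟩, fun h => h.2⟩
    | cons j w =>
      cases p with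
      | nil => simp
      | cons k p =>
        by_cases hij : i = j
        · subst hij
          simp only [nca, if_true, List.cons_prefix_cons, ih]
          tauto
        · simp only [nca, hij, if_false, List.prefix_nil, List.cons_prefix_cons]
          constructor
          · simp
          · rintro ⟨⟨rfl, -⟩, rfl, -⟩
            exact absurd rfl hij

/-! ### Finiteness and maximal elements -/

theorem mem_pos_cons {a : α} {cs : List (OTree α)} {i : ℕ} {p : Node} :
    i :: p ∈ Pos (node a cs) ↔ ∃ h : i < cs.length, p ∈ Pos cs[i] := by
  by_cases h : i < cs.length
  · simp [Pos, sub, children, h]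
  · simp [Pos, sub, children, h]

theorem nil_mem_pos (t : OTree α) : [] ∈ Pos t := by simp [Pos, sub]

theorem labelAt_cons {a : α} {cs : List (OTree α)} {i : ℕ} {p : Node} (h : i < cs.length) :
    labelAt (node a cs) (i :: p) = labelAt cs[i] p := by
  simp [labelAt, sub, children, h]

theorem mem_pos_of_labelAt {t : OTree α} {p : Node} {a : α} (h : labelAt t p = some a) :
    p ∈ Pos t := by
  intro hn
  simp [labelAt, hn] at h

theorem finite_pos : ∀ t : OTree α, (Pos t).Finite
  | node a cs => by
    have hsub : Pos (node a cs) ⊆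
        {[]} ∪ ⋃ i : Fin cs.length, (fun p => (i : ℕ) :: p) '' Pos cs[i] := by
      rintro (_ | ⟨i, p⟩) hp
      · simp
      · obtain ⟨h, hp⟩ := mem_pos_cons.mp hp
        right
        exact Set.mem_iUnion.mpr ⟨⟨i, h⟩, p, hp, rfl⟩
    refine Set.Finite.subset ((Set.finite_singleton _).union (Set.finite_iUnion ?_)) hsub
    intro i
    exact (finite_pos cs[i]).image _
termination_by t => sizeOf t
decreasing_by
  have := List.sizeOf_lt_of_mem (List.getElem_mem (l := cs) i.2)
  simp only [OTree.node.sizeOf_spec, Fin.getElem_fin]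
  omega

theorem exists_prefix_mem_deepOf {S : Set Node} (hS : S.Finite) {x : Node} (hx : x ∈ S) :
    ∃ m ∈ DeepOf S, x <+: m := by
  obtain ⟨m, ⟨hm, hxm⟩, hmax⟩ := Set.exists_max_image {m | m ∈ S ∧ x <+: m} List.length
    (hS.subset fun _ h => h.1) ⟨x, hx, List.prefix_rfl⟩
  refine ⟨m, ⟨hm, ?_⟩, hxm⟩
  rintro ⟨z, hz, hmz⟩
  exact absurd (hmax z ⟨hz, hxm.trans hmz.1⟩) (not_le.mpr hmz.length_lt)

theorem exists_flAt {T : OTree α} {w n : Node} {a : α} (hw : w <+: n)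
    (hl : labelAt T w = some a) : ∃ q, FlAt T n a q ∧ w <+: q := by
  obtain ⟨q, ⟨⟨hqn, hql⟩, hmax⟩, hwq⟩ :=
    exists_prefix_mem_deepOf (S := {q | q <+: n ∧ labelAt T q = some a})
      ((finite_pos T).subset fun _ h => mem_pos_of_labelAt h.2) ⟨hw, hl⟩
  exact ⟨q, ⟨hqn, hql, fun r hr hrn hrl => hmax ⟨r, ⟨hrn, hrl⟩, hr⟩⟩, hwq⟩

theorem deepOf_eq_of_cofinal {A B : Set Node} (hBA : B ⊆ A)
    (h : ∀ x ∈ A, ∃ y ∈ B, x <+: y) : DeepOf A = DeepOf B := by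
  ext x
  constructor
  · rintro ⟨hx, hmax⟩
    obtain ⟨y, hy, hxy⟩ := h x hx
    have hxy' : x = y := by
      by_contra hne
      exact hmax ⟨y, hBA hy, hxy, hne⟩
    subst hxy'
    exact ⟨hy, fun ⟨z, hz, hxz⟩ => hmax ⟨z, hBA hz, hxz⟩⟩
  · rintro ⟨hx, hmax⟩
    refine ⟨hBA hx, fun ⟨z, hz, hxz⟩ => ?_⟩
    obtain ⟨y, hy, hzy⟩ := h z hz
    exact hmax ⟨y, hy, hxz.trans_anc hzy⟩

/-! ### Occurrences -/

/-- The images of the root of `P` under all embeddings of `P` in `T`, deep or not. -/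
def occ (P T : OTree α) : Set Node := {w | ∃ f, IsEmb P T f ∧ f [] = w}

theorem emb_eq_deepOf_occ (P T : OTree α) : emb P T = DeepOf (occ P T) := by
  ext w
  constructor
  · rintro ⟨f, ⟨hf, hd⟩, rfl⟩
    refine ⟨⟨f, hf, rfl⟩, ?_⟩
    rintro ⟨_, ⟨g, hg, rfl⟩, h⟩
    exact hd ⟨g, hg, h⟩
  · rintro ⟨⟨f, hf, rfl⟩, hd⟩
    exact ⟨f, ⟨hf, fun ⟨g, hg, h⟩ => hd ⟨_, ⟨g, hg, rfl⟩, h⟩⟩, rfl⟩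

theorem occ_subset_pos (P T : OTree α) : occ P T ⊆ Pos T := by
  rintro _ ⟨f, hf, rfl⟩
  exact hf.mem _ (nil_mem_pos P)

theorem emb_subset_occ (P T : OTree α) : emb P T ⊆ occ P T := by
  rw [emb_eq_deepOf_occ]
  exact fun _ h => h.1

theorem deepSet_emb (P T : OTree α) : DeepSet (emb P T) := by
  rw [emb_eq_deepOf_occ]
  exact fun x hx y hy h => hx.2 ⟨y, hy.1, h⟩

theorem IsEmb.root_anc {P T : OTree α} {f : Node → Node} (hf : IsEmb P T f) {p : Node}
    (hp : p ∈ Pos P) : f [] <+: f p := by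
  cases p with
  | nil => exact List.prefix_rfl
  | cons i p => exact ((hf.anc _ (nil_mem_pos P) _ hp).mp ⟨(nil_anc _), by simp⟩).1

theorem IsEmb.child {a : α} {cs : List (OTree α)} {T : OTree α} {f : Node → Node}
    (hf : IsEmb (node a cs) T f) {i : ℕ} (hi : i < cs.length) :
    IsEmb cs[i] T (fun p => f (i :: p)) := by
  have hmem : ∀ p ∈ Pos cs[i], i :: p ∈ Pos (node a cs) :=
    fun p hp => mem_pos_cons.mpr ⟨hi, hp⟩
  refine ⟨fun p hp => hf.mem _ (hmem p hp), fun p hp q hq h => ?_, fun p hp => ?_,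
    fun p hp q hq => ?_, fun p hp q hq => ?_⟩
  · exact (List.cons.inj (hf.inj _ (hmem p hp) _ (hmem q hq) h)).2
  · rw [hf.lab _ (hmem p hp), labelAt_cons hi]
  · rw [← hf.anc _ (hmem p hp) _ (hmem q hq), sAnc_cons]
    simp
  · rw [← hf.ord _ (hmem p hp) _ (hmem q hq), leftOf_cons]
    simp

theorem isEmb_of_children {a : α} {cs : List (OTree α)} {T : OTree α} {f : Node → Node}
    (hl : labelAt T (f []) = some a)
    (hc : ∀ i, ∀ hi : i < cs.length, IsEmb cs[i] T (fun p => f (i :: p)))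
    (hanc : ∀ i < cs.length, SAnc (f []) (f [i]))
    (hord : ∀ i j, i < j → j < cs.length → LeftOf (f [i]) (f [j])) :
    IsEmb (node a cs) T f := by
  have hanc' : ∀ i p, i :: p ∈ Pos (node a cs) → SAnc (f []) (f (i :: p)) := by
    intro i p hp
    obtain ⟨hi, hp⟩ := mem_pos_cons.mp hp
    exact (hanc i hi).trans_anc ((hc i hi).root_anc hp)
  have hord' : ∀ i j p q, i :: p ∈ Pos (node a cs) → j :: q ∈ Pos (node a cs) → i < j →
      LeftOf (f (i :: p)) (f (j :: q)) := by
    intro i j p q hp hq hij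
    obtain ⟨hi, hp⟩ := mem_pos_cons.mp hp
    obtain ⟨hj, hq⟩ := mem_pos_cons.mp hq
    exact (hord i j hij hj).mono ((hc i hi).root_anc hp) ((hc j hj).root_anc hq)
  constructor
  · rintro (_ | ⟨i, p⟩) hp
    · exact mem_pos_of_labelAt hl
    · obtain ⟨hi, hp⟩ := mem_pos_cons.mp hp
      exact (hc i hi).mem p hp
  · rintro (_ | ⟨i, p⟩) hp (_ | ⟨j, q⟩) hq h
    · rfl
    · exact absurd h (hanc' j q hq).2
    · exact absurd h.symm (hanc' i p hp).2
    · rcases lt_trichotomy i j with hij | rfl | hij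
      · exact absurd h (hord' i j p q hp hq hij).ne
      · obtain ⟨hi, hp⟩ := mem_pos_cons.mp hp
        obtain ⟨_, hq⟩ := mem_pos_cons.mp hq
        rw [(hc i hi).inj p hp q hq h]
      · exact absurd h.symm (hord' j i q p hq hp hij).ne
  · rintro (_ | ⟨i, p⟩) hp
    · rw [hl]
      rfl
    · obtain ⟨hi, hp⟩ := mem_pos_cons.mp hp
      rw [labelAt_cons hi, (hc i hi).lab p hp]
  · rintro (_ | ⟨i, p⟩) hp (_ | ⟨j, q⟩) hq
    · simp [SAnc]
    · exact iff_of_true ⟨(nil_anc _), by simp⟩ (hanc' j q hq)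
    · exact iff_of_false (by simp [SAnc]) fun h => (hanc' i p hp).not_anc h.1
    · rcases lt_trichotomy i j with hij | rfl | hij
      · exact iff_of_false (fun h => hij.ne (sAnc_cons.mp h).1)
          fun h => (hord' i j p q hp hq hij).not_anc h.1
      · obtain ⟨hi, hp⟩ := mem_pos_cons.mp hp
        obtain ⟨_, hq⟩ := mem_pos_cons.mp hq
        rw [← (hc i hi).anc p hp q hq, sAnc_cons]
        simp
      · exact iff_of_false (fun h => hij.ne' (sAnc_cons.mp h).1)
          fun h => (hord' j i q p hq hp hij).not_anc' h.1
  · rintro (_ | ⟨i, p⟩) hp (_ | ⟨j, q⟩) hq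
    · exact iff_of_false (LeftOf.irrefl _) (LeftOf.irrefl _)
    · exact iff_of_false (not_leftOf_nil_left _)
        fun h => h.not_anc (hanc' j q hq).1
    · exact iff_of_false (not_leftOf_nil_right _)
        fun h => h.not_anc' (hanc' i p hp).1
    · rcases lt_trichotomy i j with hij | rfl | hij
      · exact iff_of_true (leftOf_cons.mpr (Or.inl hij)) (hord' i j p q hp hq hij)
      · obtain ⟨hi, hp⟩ := mem_pos_cons.mp hp
        obtain ⟨_, hq⟩ := mem_pos_cons.mp hq
        rw [← (hc i hi).ord p hp q hq, leftOf_cons]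
        simp
      · refine iff_of_false (fun h => ?_) (hord' j i q p hq hp hij).asymm
        rcases leftOf_cons.mp h with h | h <;> omega

theorem mem_occ_node_iff {a : α} {cs : List (OTree α)} {T : OTree α} {w : Node} :
    w ∈ occ (node a cs) T ↔ labelAt T w = some a ∧ ∃ x : ℕ → Node,
      (∀ i, ∀ hi : i < cs.length, x i ∈ emb cs[i] T ∧ SAnc w (x i)) ∧
      ∀ i j, i < j → j < cs.length → LeftOf (x i) (x j) := by
  constructor
  · rintro ⟨f, hf, rfl⟩
    have hnil : ∀ i < cs.length, [i] ∈ Pos (node a cs) :=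
      fun i hi => mem_pos_cons.mpr ⟨hi, nil_mem_pos _⟩
    have hx : ∀ i, ∃ x : Node, ∀ hi : i < cs.length, x ∈ emb cs[i] T ∧ f [i] <+: x := by
      intro i
      by_cases hi : i < cs.length
      · obtain ⟨m, hm, hpre⟩ := exists_prefix_mem_deepOf (S := occ cs[i] T)
          ((finite_pos T).subset (occ_subset_pos _ _)) ⟨_, hf.child hi, rfl⟩
        exact ⟨m, fun _ => ⟨by rwa [emb_eq_deepOf_occ], hpre⟩⟩
      · exact ⟨[], fun h => absurd h hi⟩
    choose x hx using hx
    refine ⟨hf.lab _ (nil_mem_pos _), x, fun i hi => ⟨(hx i hi).1, ?_⟩, fun i j hij hj => ?_⟩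
    · exact ((hf.anc _ (nil_mem_pos _) _ (hnil i hi)).mp
        ⟨(nil_anc _), by simp⟩).trans_anc (hx i hi).2
    · refine LeftOf.mono ?_ (hx i (hij.trans hj)).2 (hx j hj).2
      exact (hf.ord _ (hnil i (hij.trans hj)) _ (hnil j hj)).mp
        (leftOf_cons.mpr (Or.inl hij))
  · rintro ⟨hl, x, hx, hord⟩
    have hF : ∀ i, ∃ F : Node → Node, ∀ hi : i < cs.length, IsEmb cs[i] T F ∧ F [] = x i := by
      intro i
      by_cases hi : i < cs.length
      · obtain ⟨F, hF, h⟩ := emb_subset_occ _ _ (hx i hi).1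
        exact ⟨F, fun _ => ⟨hF, h⟩⟩
      · exact ⟨id, fun h => absurd h hi⟩
    choose F hF using hF
    let f : Node → Node := fun p => match p with
      | [] => w
      | i :: p => F i p
    refine ⟨f, isEmb_of_children hl (fun i hi => (hF i hi).1) (fun i hi => ?_)
      (fun i j hij hj => ?_), rfl⟩
    · change SAnc w (F i [])
      rw [(hF i hi).2]
      exact (hx i hi).2
    · change LeftOf (F i []) (F j [])
      rw [(hF i (hij.trans hj)).2, (hF j hj).2]
      exact hord i j hij hj

/-! ### Ordered tuples and minimum ordered pairs -/

instance : IsTrans Node LeftOf := ⟨fun _ _ _ => LeftOf.trans⟩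

theorem exists_phi_iff {Xs : List (Set Node)} (hXs : 0 < Xs.length) {w1 wk : Node} :
    (∃ xs, Phi Xs xs ∧ xs.head? = some w1 ∧ xs.getLast? = some wk) ↔
      ∃ x : ℕ → Node, (∀ i, ∀ hi : i < Xs.length, x i ∈ Xs[i]) ∧
        (∀ i j, i < j → j < Xs.length → LeftOf (x i) (x j)) ∧
        x 0 = w1 ∧ x (Xs.length - 1) = wk := by
  constructor
  · rintro ⟨xs, ⟨hmem, hch⟩, h1, hk⟩
    have hlen := hmem.length_eq
    have hpw : xs.Pairwise LeftOf := List.isChain_iff_pairwise.mp hch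
    refine ⟨fun i => xs.getD i [], fun i hi => ?_, fun i j hij hj => ?_, ?_, ?_⟩
    · have hi' : i < xs.length := by omega
      simp only [List.getD_eq_getElem?_getD, List.getElem?_eq_getElem hi', Option.getD_some]
      exact (List.forall₂_iff_get.mp hmem).2 i hi' hi
    · have hj' : j < xs.length := by omega
      have hi' : i < xs.length := by omega
      simp only [List.getD_eq_getElem?_getD, List.getElem?_eq_getElem hi',
        List.getElem?_eq_getElem hj', Option.getD_some]
      exact List.pairwise_iff_getElem.mp hpw i j hi' hj' hij
    · rw [List.head?_eq_getElem?] at h1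
      simp [List.getD_eq_getElem?_getD, h1]
    · rw [List.getLast?_eq_getElem?, hlen] at hk
      simp [List.getD_eq_getElem?_getD, hk]
  · rintro ⟨x, hmem, hord, rfl, rfl⟩
    refine ⟨List.ofFn (fun i : Fin Xs.length => x i), ⟨?_, ?_⟩, ?_, ?_⟩
    · rw [List.forall₂_iff_get]
      refine ⟨by simp, fun i h1 h2 => ?_⟩
      simpa using hmem i h2
    · refine List.isChain_iff_pairwise.mpr (List.pairwise_iff_getElem.mpr ?_)
      intro i j hi hj hij
      simp only [List.length_ofFn] at hi hj
      simpa using hord i j hij hj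
    · simp [List.head?_eq_getElem?, hXs]
    · simp [List.getLast?_eq_getElem?, hXs]

/-- `y` is strictly nested inside `p`: it starts no earlier and ends no later than `p`, and
one of the two inequalities is strict. -/
def Nested (y p : Node × Node) : Prop :=
  (LeftOf p.1 y.1 ∧ (LeftOf y.2 p.2 ∨ y.2 = p.2)) ∨
    ((LeftOf p.1 y.1 ∨ p.1 = y.1) ∧ LeftOf y.2 p.2)

instance : IsStrictOrder (Node × Node) Nested where
  irrefl p h := by
    rcases h with h | h
    · exact LeftOf.irrefl _ h.1
    · exact LeftOf.irrefl _ h.2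
  trans := by
    rintro ⟨a, b⟩ ⟨c, d⟩ ⟨e, f⟩ h1 h2
    simp only [Nested] at *
    have t1 : LeftOf e c → LeftOf c a → LeftOf e a := LeftOf.trans
    have t2 : LeftOf b d → LeftOf d f → LeftOf b f := LeftOf.trans
    rcases h1 with ⟨h1, h1' | rfl⟩ | ⟨h1 | rfl, h1'⟩ <;>
      rcases h2 with ⟨h2, h2' | rfl⟩ | ⟨h2 | rfl, h2'⟩ <;> tauto

theorem DeepSet.leftOrAbove_iff {X : Set Node} (hX : DeepSet X) {u w : Node} (hu : u ∈ X)
    (hw : w ∈ X) : LeftOrAbove u w ↔ LeftOf u w ∨ u = w := by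
  constructor
  · rintro (h | h | h)
    · exact Or.inl h
    · by_contra hc
      exact hX u hu w hw ⟨h, fun e => hc (Or.inr e)⟩
    · exact absurd h (hX w hw u hu)
  · rintro (h | rfl)
    · exact Or.inl h
    · exact Or.inr (Or.inl List.prefix_rfl)

theorem exists_mop {Xs : List (Set Node)} (hXs : 0 < Xs.length)
    (hdeep : ∀ X ∈ Xs, DeepSet X) (hfin : ∀ X ∈ Xs, X.Finite) {w1 wk : Node}
    (h : ∃ xs, Phi Xs xs ∧ xs.head? = some w1 ∧ xs.getLast? = some wk) :
    ∃ p ∈ Mop Xs, (LeftOf w1 p.1 ∨ w1 = p.1) ∧ (LeftOf p.2 wk ∨ p.2 = wk) := by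
  have hk : Xs.length - 1 < Xs.length := by omega
  let S : Set (Node × Node) :=
    {p | ∃ xs, Phi Xs xs ∧ xs.head? = some p.1 ∧ xs.getLast? = some p.2}
  have hS : ∀ p ∈ S, p.1 ∈ Xs[0] ∧ p.2 ∈ Xs[Xs.length - 1] := by
    rintro ⟨u, w⟩ hp
    obtain ⟨x, hx, -, rfl, rfl⟩ := (exists_phi_iff hXs).mp hp
    exact ⟨hx _ hXs, hx _ hk⟩
  have hSfin : S.Finite :=
    ((hfin _ (List.getElem_mem hXs)).prod (hfin _ (List.getElem_mem hk))).subset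
      fun p hp => hS p hp
  refine (hSfin.wellFoundedOn (r := Nested)).induction (x := (w1, wk))
    (P := fun q => ∃ p ∈ Mop Xs, (LeftOf q.1 p.1 ∨ q.1 = p.1) ∧ (LeftOf p.2 q.2 ∨ p.2 = q.2))
    h ?_
  intro q hq ih
  by_cases hqm : q ∈ Mop Xs
  · exact ⟨q, hqm, Or.inr rfl, Or.inr rfl⟩
  · have hex : ∃ y ∈ S, Nested y q := by
      by_contra hno
      refine hqm ⟨hq, ?_⟩
      rintro ⟨ys, y1, yk, hys, h1, h2, hlt⟩
      have hy : (y1, yk) ∈ S := ⟨ys, hys, h1, h2⟩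
      rw [(hdeep _ (List.getElem_mem hk)).leftOrAbove_iff (hS _ hy).2 (hS _ hq).2,
        (hdeep _ (List.getElem_mem hXs)).leftOrAbove_iff (hS _ hq).1 (hS _ hy).1] at hlt
      refine hno ⟨_, hy, ?_⟩
      rcases hlt with ⟨a, -, b⟩ | ⟨a, -, b⟩
      · exact Or.inl ⟨a, b⟩
      · exact Or.inr ⟨a, b⟩
    obtain ⟨y, hy, hyq⟩ := hex
    obtain ⟨p, hp, hp1, hp2⟩ := ih y hy hyq
    refine ⟨p, hp, ?_⟩
    have t1 : LeftOf q.1 y.1 → LeftOf y.1 p.1 → LeftOf q.1 p.1 := LeftOf.trans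
    have t2 : LeftOf p.2 y.2 → LeftOf y.2 q.2 → LeftOf p.2 q.2 := LeftOf.trans
    unfold Nested at hyq
    constructor
    · rcases hp1 with hp1 | hp1
      · rcases hyq with ⟨h, -⟩ | ⟨h | h, -⟩
        · exact Or.inl (t1 h hp1)
        · exact Or.inl (t1 h hp1)
        · exact Or.inl (h ▸ hp1)
      · rw [← hp1]
        tauto
    · rcases hp2 with hp2 | hp2
      · rcases hyq with ⟨-, h | h⟩ | ⟨-, h⟩
        · exact Or.inl (t2 hp2 h)
        · exact Or.inl (h ▸ hp2)
        · exact Or.inl (t2 hp2 h)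
      · rw [hp2]
        tauto

/-- For a node `v` of `P` with children `v_1, …, v_k`, `k ≥ 2`:
`emb(P(v),T) = Deep({fl(nca(w_1,w_k), label(v)) :
(w_1,w_k) ∈ mop(emb(P(v_1),T), …, emb(P(v_k),T))} ∖ {⊥})`. -/
theorem emb_internal_case {α : Type} (P T : OTree α) (v : Node) (a : α)
    (cs : List (OTree α)) (hs : sub v P = some (OTree.node a cs))
    (hk : 2 ≤ cs.length) :
    emb (OTree.node a cs) T =
      DeepOf {q | ∃ w1 wk : Node,
        (w1, wk) ∈ Mop (cs.map (fun c => emb c T)) ∧ FlAt T (nca w1 wk) a q} := by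
  have hlen : (cs.map (fun c => emb c T)).length = cs.length := List.length_map ..
  have hpos : 0 < (cs.map (fun c => emb c T)).length := by omega
  rw [emb_eq_deepOf_occ]
  apply deepOf_eq_of_cofinal
  · rintro q ⟨w1, wk, ⟨hphi, -⟩, hq, hl, -⟩
    obtain ⟨x, hx, hord, rfl, rfl⟩ := (exists_phi_iff hpos).mp hphi
    simp only [hlen, List.getElem_map] at hx hord hq
    obtain ⟨hq1, hqk⟩ := prefix_nca_iff.mp hq
    refine mem_occ_node_iff.mpr ⟨hl, x, fun i hi => ⟨hx i hi, ?_⟩, hord⟩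
    rcases Nat.eq_zero_or_pos i with rfl | h0
    · refine ⟨hq1, fun h => ?_⟩
      exact (hord 0 (cs.length - 1) (by omega) (by omega)).not_anc (h ▸ hqk)
    · have h0i := hord 0 i h0 hi
      refine ⟨?_, fun h => h0i.not_anc' (h ▸ hq1)⟩
      rcases Nat.lt_or_ge i (cs.length - 1) with hik | hik
      · exact prefix_of_between hq1 hqk h0i (hord i _ hik (by omega))
      · rwa [show i = cs.length - 1 by omega]
  · intro w hw
    obtain ⟨hl, x, hx, hord⟩ := mem_occ_node_iff.mp hw
    obtain ⟨⟨w1, wk⟩, hmop, h1, hk'⟩ := exists_mop hpos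
      (by
        simp only [List.mem_map]
        rintro _ ⟨c, -, rfl⟩
        exact deepSet_emb c T)
      (by
        simp only [List.mem_map]
        rintro _ ⟨c, -, rfl⟩
        exact (finite_pos T).subset ((emb_subset_occ c T).trans (occ_subset_pos c T)))
      ((exists_phi_iff hpos).mpr ⟨x, fun i hi => by
          rw [List.getElem_map]
          exact (hx i (by omega)).1,
        fun i j hij hj => hord i j hij (by omega), rfl, rfl⟩)
    simp only [hlen] at h1 hk'
    have hw0 : w <+: x 0 := (hx 0 (by omega)).2.1
    have hwk : w <+: x (cs.length - 1) := (hx _ (by omega)).2.1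
    have h1k : LeftOf w1 wk := by
      obtain ⟨y, -, hy, rfl, rfl⟩ := (exists_phi_iff hpos).mp hmop.1
      exact hy _ _ (by omega) (by omega)
    have hw1 : w <+: w1 := by
      rcases h1 with h1 | h1
      · refine prefix_of_between hw0 hwk h1 ?_
        rcases hk' with h | h
        · exact h1k.trans h
        · exact h ▸ h1k
      · exact h1 ▸ hw0
    have hwk' : w <+: wk := by
      rcases hk' with h | h
      · refine prefix_of_between hw0 hwk ?_ h
        rcases h1 with h1 | h1
        · exact h1.trans h1k
        · exact h1 ▸ h1k
      · exact h ▸ hwk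
    obtain ⟨q, hq, hwq⟩ := exists_flAt (prefix_nca_iff.mpr ⟨hw1, hwk'⟩) hl
    exact ⟨q, ⟨w1, wk, hmop, hq⟩, hwq⟩

end OTree

end TreeIncl
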